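/- Let q, Q be integers with 2 < q ≤ Q ≤ Q(q), where Q(q) = ⌊(2√(q−1) + 1 + √(4√(q−1) + 1))²/4⌋ + 1, let S be a subtree of constant internal degree q of 𝔾^Q with root 0 ∈ S, A_{𝔾^{Q,q}} = A_{𝔾^Q} + P_{ℓ²(S)}, λ* := ‖A_{𝔾^{Q,q}}‖ > 2√(Q−1), and S(λ) := P_{ℓ²(S)} R_{A_{𝔾^Q}}(λ) restricted to ℓ²(S). Then for λ > λ*: R_{A_{𝔾^{Q,q}}}(λ) = R_{A_{𝔾^Q}}(λ)( I + P_{ℓ²(S)} (I_{ℓ²(S)} − S(λ))^{-1} P_{ℓ²(S)} R_{A_{𝔾^Q}}(λ) ). Moreover A_{𝔾^{Q,q}} is transient; more precisely, lim_{λ ↓ λ*} ⟨R_{A_{𝔾^{Q,q}}}(λ) δ_0, δ_0⟩ = (1 − a(λ*)√(q−1))² √(q−1) / (a(λ*)(q−2)) < +∞, where a(λ) = λ(1 − √(1 − 4(Q−1)/λ²))/(2(Q−1)). -/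

import Mathlib

open Filter MeasureTheory Set
open scoped Topology Classical ENNReal

noncomputable section

/-- The Hilbert space ℓ²(V) with complex coefficients. -/
abbrev L2 (V : Type) := lp (fun _ : V => ℂ) 2

/-- The coordinate (delta) vector at a vertex `x`. -/
def delta {V : Type} (x : V) : L2 V :=
  haveI := Classical.decEq V; lp.single 2 x 1

/-- The matrix entry `B_{x y} = (B δ_y)(x)` of a bounded operator on ℓ²(V). -/
def entry {V : Type} (B : L2 V →L[ℂ] L2 V) (x y : V) : ℂ :=
  (B (delta y) : ∀ _ : V, ℂ) x

/-- The resolvent `R_B(z) = (z·1 − B)⁻¹` (junk value if not invertible). -/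
def Res {V : Type} (B : L2 V →L[ℂ] L2 V) (z : ℂ) : L2 V →L[ℂ] L2 V :=
  Ring.inverse (z • (1 : L2 V →L[ℂ] L2 V) - B)

/-- The resolvent at a real point. -/
def ResR {V : Type} (B : L2 V →L[ℂ] L2 V) (l : ℝ) : L2 V →L[ℂ] L2 V :=
  Res B (l : ℂ)

/-- `G` is the homogeneous Cayley tree of degree `Q`: connected, acyclic,
and every vertex has exactly `Q` neighbours. -/
structure IsCayleyTree {V : Type} (G : SimpleGraph V) (Q : ℕ) : Prop where
  conn : G.Connected
  acyc : G.IsAcyclic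
  deg : ∀ v : V, (G.neighborSet v).ncard = Q

/-- `A` is the adjacency operator of the simple graph `G` on ℓ²(V). -/
def IsAdjacencyOp {V : Type} (G : SimpleGraph V) (A : L2 V →L[ℂ] L2 V) : Prop :=
  ∀ x y : V, entry A x y = if G.Adj x y then 1 else 0

/-- `P` assigns to each subset `S ⊆ V` the orthogonal projection of ℓ²(V) onto ℓ²(S). -/
def IsProjFamily {V : Type} (P : Set V → (L2 V →L[ℂ] L2 V)) : Prop :=
  ∀ (S : Set V) (f : L2 V) (x : V),
    (P S f : ∀ _ : V, ℂ) x = if x ∈ S then (f : ∀ _ : V, ℂ) x else 0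

/-- `S` is the vertex set of a connected subtree of `G` in which every vertex has
exactly `q` neighbours within `S` (a subtree of constant internal degree `q`). -/
def IsRegularSubtree {V : Type} (G : SimpleGraph V) (S : Set V) (q : ℕ) : Prop :=
  (G.induce S).Connected ∧ ∀ x ∈ S, {y : V | y ∈ S ∧ G.Adj x y}.ncard = q

/-- Distance from a vertex to a set of vertices. -/
def distToSet {V : Type} (G : SimpleGraph V) (x : V) (S : Set V) : ℕ :=
  sInf {n : ℕ | ∃ y ∈ S, G.dist x y = n}

/-- `a(λ)` of equation (4.2) of the paper, for the tree of degree `Q`. -/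
def aF (Q : ℕ) (l : ℝ) : ℝ :=
  l * (1 - Real.sqrt (1 - 4 * ((Q : ℝ) - 1) / l ^ 2)) / (2 * ((Q : ℝ) - 1))

/-- `μ(λ)` of equation (4.3) of the paper, for the tree of degree `Q`. -/
def muF (Q : ℕ) (l : ℝ) : ℝ :=
  l * (((Q : ℝ) - 2) + (Q : ℝ) * Real.sqrt (1 - 4 * ((Q : ℝ) - 1) / l ^ 2)) /
    (2 * ((Q : ℝ) - 1))

/-- `M` realizes the inverse, within the corner algebra `P·B(ℓ²)·P`, of the operator
`P − P T P` (that is, of `I_{ℓ²(S)} − S(λ)` when `T` is the resolvent and `P = P_{ℓ²(S)}`). -/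
def IsCornerInverse {V : Type} (P M T : L2 V →L[ℂ] L2 V) : Prop :=
  P ∘L M = M ∧ M ∘L P = M ∧
    M ∘L (P - P ∘L T ∘L P) = P ∧ (P - P ∘L T ∘L P) ∘L M = P

/-- The threshold `Q(q) = ⌊(2√(q−1) + 1 + √(4√(q−1) + 1))²/4⌋ + 1` of Proposition 6.2. -/
def Qbound (q : ℕ) : ℕ :=
  ⌊(2 * Real.sqrt ((q : ℝ) - 1) + 1 +
      Real.sqrt (4 * Real.sqrt ((q : ℝ) - 1) + 1)) ^ 2 / 4⌋₊ + 1

/-- A rooted description of a tree together with a subtree `S` containing the root: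
`p` is the parent map, `d` the depth, and `C x`, `D x` are the children of `x` inside and
outside `S`. Every vertex has `Q` neighbours, and every vertex of `S` has `q` neighbours in `S`. -/
structure RootedSubtree {V : Type} (S : Set V) (root : V) (p : V → V) (d : V → ℕ)
    (C D : V → Finset V) (q Q : ℕ) : Prop where
  root_mem : root ∈ S
  depth_eq_zero : ∀ x, d x = 0 ↔ x = root
  depth_parent : ∀ x, x ≠ root → d (p x) + 1 = d x
  parent_mem : ∀ x, x ∈ S → x ≠ root → p x ∈ S
  mem_inner : ∀ x y, y ∈ C x ↔ y ≠ root ∧ p y = x ∧ y ∈ S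
  mem_outer : ∀ x y, y ∈ D x ↔ y ≠ root ∧ p y = x ∧ y ∉ S
  card_inner : ∀ x, x ∈ S → x ≠ root → (C x).card + 1 = q
  card_inner_root : (C root).card = q
  card_outer : ∀ x, x ∈ S → (D x).card + q = Q
  card_outer_of_notMem : ∀ x, x ∉ S → (D x).card + 1 = Q

/-- The parent map and the depth function of a tree rooted at a vertex of a subtree `S`. -/
theorem exists_parent {V : Type} {G : SimpleGraph V} (hG : G.IsTree) {S : Set V}
    (hS : (G.induce S).Connected) {root : V} (hroot : root ∈ S) :
    ∃ (p : V → V) (d : V → ℕ), (∀ x, d x = 0 ↔ x = root) ∧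
      (∀ x, x ≠ root → d (p x) + 1 = d x) ∧ (∀ x, x ∈ S → x ≠ root → p x ∈ S) ∧
      ∀ x y, G.Adj x y ↔ (y ≠ root ∧ p y = x) ∨ (x ≠ root ∧ p x = y) := by
  have hex : ∀ x, ∃ w : G.Walk x root, w.IsPath := fun x => (hG.existsUnique_path x root).exists
  choose w hw using hex
  have huniq : ∀ x (v : G.Walk x root), v.IsPath → v = w x := fun x v hv =>
    (hG.existsUnique_path x root).unique hv (hw x)
  have hnil : ∀ x, x ≠ root → ¬ (w x).Nil := fun x hx h => hx h.eq
  have hadj : ∀ x, x ≠ root → G.Adj x (w x).snd := fun x hx => (w x).adj_snd (hnil x hx)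
  have key : ∀ x y, G.Adj x y → y ∉ (w x).support → y ≠ root ∧ (w y).snd = x := by
    intro x y hxy hy
    have hp : (SimpleGraph.Walk.cons hxy.symm (w x)).IsPath := (hw x).cons hy
    refine ⟨fun h => hy (h ▸ (w x).end_mem_support), ?_⟩
    rw [← huniq y _ hp]
    simp
  refine ⟨fun x => (w x).snd, fun x => (w x).length, ?_, ?_, ?_, ?_⟩
  · intro x
    refine ⟨fun h => SimpleGraph.Walk.eq_of_length_eq_zero h, ?_⟩
    rintro rfl
    exact (SimpleGraph.Walk.isPath_iff_nil.mp (hw x)).length_eq_zero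
  · intro x hx
    have := huniq _ _ (hw x).tail
    simp only [← this]
    exact SimpleGraph.Walk.length_tail_add_one (hnil x hx)
  · intro x hx hne
    obtain ⟨v, hv⟩ := (hS.preconnected ⟨x, hx⟩ ⟨root, hroot⟩).exists_isPath
    have hmap : (v.map (SimpleGraph.Embedding.induce S).toHom).IsPath :=
      hv.map Subtype.val_injective
    have := huniq x _ hmap
    have h2 : (w x).snd = (v.snd : V) := by
      rw [← this]
      cases v with
      | nil => rfl
      | cons h v =>
        rw [SimpleGraph.Walk.snd_cons]
        exact SimpleGraph.Walk.snd_cons _ _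
    simp only [h2]
    exact v.snd.2
  · intro x y
    constructor
    · intro h
      by_cases hy : y ∈ (w x).support
      · right
        have hx : x ≠ root := by
          rintro rfl
          have := (SimpleGraph.Walk.isPath_iff_nil.mp (hw x))
          rw [SimpleGraph.Walk.nil_iff_support_eq.mp this] at hy
          exact h.ne (List.mem_singleton.mp hy).symm
        exact ⟨hx, (hG.isAcyclic.eq_snd_of_adj_start (hw x) h hy).symm⟩
      · exact Or.inl (key x y h hy)
    · rintro (⟨h, rfl⟩ | ⟨h, rfl⟩)
      · exact (hadj y h).symm
      · exact hadj x h

theorem exists_rootedSubtree {V : Type} {G : SimpleGraph V} {q Q : ℕ} (hG : IsCayleyTree G Q)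
    (hQ : 0 < Q) {S : Set V} (hS : IsRegularSubtree G S q) {root : V}
    (hroot : root ∈ S) :
    ∃ (p : V → V) (d : V → ℕ) (C D : V → Finset V), RootedSubtree S root p d C D q Q ∧
      ∀ x y, G.Adj x y ↔ y ∈ C x ∨ y ∈ D x ∨ (x ≠ root ∧ y = p x) := by
  obtain ⟨p, d, h0, h1, h2, h3⟩ := exists_parent ⟨hG.conn, hG.acyc⟩ hS.1 hroot
  have hfin : ∀ x, (G.neighborSet x).Finite := fun x =>
    Set.finite_of_ncard_ne_zero (by rw [hG.deg x]; exact hQ.ne')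
  have hCf : ∀ x, {y | y ≠ root ∧ p y = x ∧ y ∈ S}.Finite := fun x =>
    (hfin x).subset fun y hy => (h3 x y).2 (Or.inl ⟨hy.1, hy.2.1⟩)
  have hDf : ∀ x, {y | y ≠ root ∧ p y = x ∧ y ∉ S}.Finite := fun x =>
    (hfin x).subset fun y hy => (h3 x y).2 (Or.inl ⟨hy.1, hy.2.1⟩)
  set C : V → Finset V := fun x => (hCf x).toFinset with hC
  set D : V → Finset V := fun x => (hDf x).toFinset with hD
  have mC : ∀ x y, y ∈ C x ↔ y ≠ root ∧ p y = x ∧ y ∈ S := fun x y => by simp [hC]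
  have mD : ∀ x y, y ∈ D x ↔ y ≠ root ∧ p y = x ∧ y ∉ S := fun x y => by simp [hD]
  have hpp : ∀ x y, x ≠ root → y ≠ root → p x = y → p y = x → False := by
    intro x y hx hy hxy hyx
    have a1 := h1 x hx
    have a2 := h1 y hy
    rw [hxy] at a1
    rw [hyx] at a2
    omega
  have hdisj : ∀ x, Disjoint (C x) (D x) := fun x =>
    Finset.disjoint_left.2 fun y hy hy' => ((mD x y).1 hy').2.2 ((mC x y).1 hy).2.2
  have hpC : ∀ x, x ≠ root → p x ∉ C x := fun x hx h =>
    hpp x (p x) hx ((mC _ _).1 h).1 rfl ((mC _ _).1 h).2.1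
  have hpD : ∀ x, x ≠ root → p x ∉ D x := fun x hx h =>
    hpp x (p x) hx ((mD _ _).1 h).1 rfl ((mD _ _).1 h).2.1
  have hadj : ∀ x y, G.Adj x y ↔ y ∈ C x ∨ y ∈ D x ∨ (x ≠ root ∧ y = p x) := by
    intro x y
    rw [h3, mC, mD]
    grind
  have hN : ∀ x, (C x).card + (D x).card + (if x = root then 0 else 1) = Q := by
    intro x
    rw [← hG.deg x]
    by_cases hx : x = root
    · have : G.neighborSet x = ((C x ∪ D x : Finset V) : Set V) := by
        ext y
        simp [hadj, hx]
      rw [this, Set.ncard_coe_finset, Finset.card_union_of_disjoint (hdisj x)]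
      simp [hx]
    · have : G.neighborSet x = ((insert (p x) (C x ∪ D x) : Finset V) : Set V) := by
        ext y
        simp [hadj, hx]
        tauto
      rw [this, Set.ncard_coe_finset, Finset.card_insert_of_notMem
        (by simp [hpC x hx, hpD x hx]), Finset.card_union_of_disjoint (hdisj x)]
      simp [hx]
  have hNS : ∀ x ∈ S, (C x).card + (if x = root then 0 else 1) = q := by
    intro x hxS
    rw [← hS.2 x hxS]
    by_cases hx : x = root
    · have : {y | y ∈ S ∧ G.Adj x y} = ((C x : Finset V) : Set V) := by
        ext y
        simp [h3, mC, hx]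
        tauto
      rw [this, Set.ncard_coe_finset]
      simp [hx]
    · have : {y | y ∈ S ∧ G.Adj x y} = ((insert (p x) (C x) : Finset V) : Set V) := by
        ext y
        have := h2 x hxS hx
        simp [h3, mC, hx]
        grind
      rw [this, Set.ncard_coe_finset, Finset.card_insert_of_notMem (hpC x hx)]
      simp [hx]
  refine ⟨p, d, C, D, ⟨hroot, h0, h1, h2, mC, mD, ?_, ?_, ?_, ?_⟩, hadj⟩
  · intro x hxS hx
    simpa [hx] using hNS x hxS
  · simpa using hNS root hroot
  · intro x hxS
    have := hNS x hxS
    have := hN x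
    omega
  · intro x hxS
    have hx : x ≠ root := fun h => hxS (h ▸ hroot)
    have h := hN x
    have hC0 : C x = ∅ := Finset.eq_empty_of_forall_notMem fun y hy => by
      have := (mC x y).1 hy
      exact hxS (this.2.1 ▸ h2 y this.2.2 this.1)
    simpa [hx, hC0] using h

/-- The product of the weights `c` along the path from `x` to the root (root excluded). -/
def pathWeight {V : Type} (p : V → V) (d : V → ℕ) (c : V → ℝ) (x : V) : ℝ :=
  ∏ i ∈ Finset.range (d x), c (p^[i] x)

/-- The path weight giving each edge the weight `b` if its lower end is in `S`, and `a` otherwise. -/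
def treeFn {V : Type} (S : Set V) (p : V → V) (d : V → ℕ) (b a : ℝ) : V → ℝ :=
  pathWeight p d fun x => if x ∈ S then b else a

namespace RootedSubtree

variable {V : Type} {S : Set V} {root : V} {p : V → V} {d : V → ℕ} {C D : V → Finset V} {q Q : ℕ}

theorem treeFn_root (T : RootedSubtree S root p d C D q Q) (b a : ℝ) :
    treeFn S p d b a root = 1 := by
  simp [treeFn, pathWeight, (T.depth_eq_zero root).2 rfl]

theorem treeFn_of_ne (T : RootedSubtree S root p d C D q Q) (b a : ℝ) {x : V} (hx : x ≠ root) :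
    treeFn S p d b a x = (if x ∈ S then b else a) * treeFn S p d b a (p x) := by
  simp only [treeFn, pathWeight]
  rw [← T.depth_parent x hx, Finset.prod_range_succ']
  exact mul_comm _ _

theorem treeFn_pos (S : Set V) (p : V → V) (d : V → ℕ) {b a : ℝ} (hb : 0 < b) (ha : 0 < a)
    (x : V) : 0 < treeFn S p d b a x := by
  unfold treeFn pathWeight
  refine Finset.prod_pos fun i _ => ?_
  by_cases h : p^[i] x ∈ S <;> simp [h, hb, ha]

theorem treeFn_inner (T : RootedSubtree S root p d C D q Q) (b a : ℝ) {x y : V} (hy : y ∈ C x) :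
    treeFn S p d b a y = b * treeFn S p d b a x := by
  obtain ⟨h1, h2, h3⟩ := (T.mem_inner x y).1 hy
  rw [T.treeFn_of_ne b a h1, if_pos h3, h2]

theorem treeFn_outer (T : RootedSubtree S root p d C D q Q) (b a : ℝ) {x y : V} (hy : y ∈ D x) :
    treeFn S p d b a y = a * treeFn S p d b a x := by
  obtain ⟨h1, h2, h3⟩ := (T.mem_outer x y).1 hy
  rw [T.treeFn_of_ne b a h1, if_neg h3, h2]

theorem sum_treeFn_inner (T : RootedSubtree S root p d C D q Q) (b a : ℝ) (x : V) :
    ∑ y ∈ C x, treeFn S p d b a y = (C x).card * b * treeFn S p d b a x := by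
  rw [Finset.sum_congr rfl fun y hy => T.treeFn_inner b a hy]
  simp [mul_assoc]

theorem sum_treeFn_outer (T : RootedSubtree S root p d C D q Q) (b a : ℝ) (x : V) :
    ∑ y ∈ D x, treeFn S p d b a y = (D x).card * a * treeFn S p d b a x := by
  rw [Finset.sum_congr rfl fun y hy => T.treeFn_outer b a hy]
  simp [mul_assoc]

theorem inner_eq_empty (T : RootedSubtree S root p d C D q Q) {x : V} (hx : x ∉ S) : C x = ∅ :=
  Finset.eq_empty_of_forall_notMem fun y hy => by
    have := (T.mem_inner x y).1 hy
    exact hx (this.2.1 ▸ T.parent_mem y this.2.2 this.1)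

theorem disjoint_inner_outer (T : RootedSubtree S root p d C D q Q) (x : V) :
    Disjoint (C x) (D x) :=
  Finset.disjoint_left.2 fun y hy hy' => ((T.mem_outer x y).1 hy').2.2 ((T.mem_inner x y).1 hy).2.2

theorem parent_parent_ne (T : RootedSubtree S root p d C D q Q) {x : V} (hx : x ≠ root)
    (hpx : p x ≠ root) : p (p x) ≠ x := by
  intro h
  have a1 := T.depth_parent x hx
  have a2 := T.depth_parent (p x) hpx
  rw [h] at a2
  omega

theorem parent_notMem (T : RootedSubtree S root p d C D q Q) {x : V} (hx : x ≠ root) :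
    p x ∉ C x ∪ D x := by
  intro h
  rcases Finset.mem_union.1 h with h | h
  · have := (T.mem_inner _ _).1 h
    exact T.parent_parent_ne hx this.1 this.2.1
  · have := (T.mem_outer _ _).1 h
    exact T.parent_parent_ne hx this.1 this.2.1

/-- The sum of `treeFn S p d b a` over the neighbours of `x`, divided by its value at `x`. -/
def eigenFactor (S : Set V) (root : V) (q Q : ℕ) (b a : ℝ) (x : V) : ℝ :=
  if x = root then q * b + (Q - q) * a
  else if x ∈ S then 1 / b + (q - 1) * b + (Q - q) * a
  else 1 / a + (Q - 1) * a

theorem sum_nbr_treeFn (T : RootedSubtree S root p d C D q Q) {b a : ℝ} (hb : 0 < b) (ha : 0 < a)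
    (x : V) :
    ∑ y ∈ C x, treeFn S p d b a y + ∑ y ∈ D x, treeFn S p d b a y +
      (if x = root then 0 else treeFn S p d b a (p x)) =
    eigenFactor S root q Q b a x * treeFn S p d b a x := by
  rw [T.sum_treeFn_inner, T.sum_treeFn_outer]
  unfold eigenFactor
  split_ifs with h1 h2
  · subst h1
    rw [T.card_inner_root]
    have : ((D x).card : ℝ) = Q - q := by
      rw [← T.card_outer x T.root_mem]; push_cast; ring
    rw [this]; ring
  · rw [T.treeFn_of_ne b a h1, if_pos h2]
    have e1 : ((D x).card : ℝ) = Q - q := by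
      rw [← T.card_outer x h2]; push_cast; ring
    have e2 : ((C x).card : ℝ) = q - 1 := by
      rw [← T.card_inner x h2 h1]; push_cast; ring
    rw [e1, e2]; field_simp; ring
  · rw [T.treeFn_of_ne b a h1, if_neg h2, T.inner_eq_empty h2]
    have e1 : ((D x).card : ℝ) = Q - 1 := by
      rw [← T.card_outer_of_notMem x h2]; push_cast; ring
    rw [e1]; simp; field_simp; ring

/-- If the sum of `H` over children contracts by a factor `r < 1`, then `H` is summable. -/
theorem summable_of_children (T : RootedSubtree S root p d C D q Q) {H : V → ℝ}
    (hH : ∀ x, 0 ≤ H x) {r e : ℝ} (hr0 : 0 ≤ r) (hr : r < 1) (he : 0 ≤ e)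
    (hc : ∀ x, ∑ y ∈ C x ∪ D x, H y ≤ r * H x + if x = root then e else 0) :
    Summable H := by
  set K := (H root + e) / (1 - r) with hK
  have hr1 : 0 < 1 - r := by linarith
  have hK0 : 0 ≤ K := div_nonneg (add_nonneg (hH _) he) hr1.le
  have hKe : H root + (r * K + e) = K := by rw [hK]; field_simp; ring
  have key : ∀ n : ℕ, ∀ F : Finset V, (∀ x ∈ F, d x ≤ n) → ∑ x ∈ F, H x ≤ K := by
    intro n
    induction n with
    | zero =>
      intro F hF
      have : F ⊆ {root} := fun x hx => by
        simpa using (T.depth_eq_zero x).1 (Nat.le_zero.1 (hF x hx))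
      have h1 := Finset.sum_le_sum_of_subset_of_nonneg this fun x _ _ => hH x
      rw [Finset.sum_singleton] at h1
      nlinarith
    | succ n ih =>
      intro F hF
      set F' := F.filter (· ≠ root) with hF'
      have hsplit : ∑ x ∈ F, H x ≤ H root + ∑ x ∈ F', H x := by
        have : F ⊆ insert root F' := fun x hx => by
          by_cases h : x = root <;> simp [hF', h, hx]
        refine (Finset.sum_le_sum_of_subset_of_nonneg this fun x _ _ => hH x).trans ?_
        rw [Finset.sum_insert (by simp [hF'])]
      have hfib : ∑ x ∈ F', H x ≤ ∑ x ∈ F'.image p, (r * H x + if x = root then e else 0) := by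
        rw [← Finset.sum_fiberwise_of_maps_to (g := p) (t := F'.image p)
          (fun x hx => Finset.mem_image_of_mem p hx)]
        refine Finset.sum_le_sum fun x _ => le_trans ?_ (hc x)
        refine Finset.sum_le_sum_of_subset_of_nonneg ?_ fun x _ _ => hH x
        intro y hy
        obtain ⟨hy1, hy2⟩ := Finset.mem_filter.1 hy
        have hy3 : y ≠ root := (Finset.mem_filter.1 hy1).2
        by_cases hyS : y ∈ S
        · exact Finset.mem_union_left _ ((T.mem_inner x y).2 ⟨hy3, hy2, hyS⟩)
        · exact Finset.mem_union_right _ ((T.mem_outer x y).2 ⟨hy3, hy2, hyS⟩)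
      have hih : ∑ x ∈ F'.image p, H x ≤ K := by
        refine ih _ fun x hx => ?_
        obtain ⟨y, hy, rfl⟩ := Finset.mem_image.1 hx
        obtain ⟨hy1, hy2⟩ := Finset.mem_filter.1 hy
        have := T.depth_parent y hy2
        have := hF y hy1
        omega
      have he' : ∑ x ∈ F'.image p, (if x = root then e else 0) ≤ e := by
        rw [Finset.sum_ite_eq']
        split_ifs <;> linarith
      rw [Finset.sum_add_distrib, ← Finset.mul_sum] at hfib
      nlinarith [mul_le_mul_of_nonneg_left hih hr0]
  exact summable_of_sum_le hH fun F => key (F.sup d) F fun x hx => Finset.le_sup hx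

theorem summable_treeFn_sq (T : RootedSubtree S root p d C D q Q) (hqQ : q ≤ Q) (hq : 1 ≤ q)
    {b a : ℝ} (hb : 0 < b) (ha : 0 < a) (hb1 : (q - 1) * b ^ 2 < 1) (ha1 : (Q - 1) * a ^ 2 < 1) :
    Summable fun x => treeFn S p d b a x ^ 2 := by
  have hq' : (1 : ℝ) ≤ q := by exact_mod_cast hq
  have hQ' : (q : ℝ) ≤ Q := by exact_mod_cast hqQ
  obtain ⟨k, hk0, hk⟩ : ∃ k : ℝ, 0 < k ∧ (q - 1) * b ^ 2 + (Q - q) * a ^ 2 * k < 1 := by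
    refine ⟨(1 - (q - 1) * b ^ 2) / ((Q - q) * a ^ 2 + 1), by
      have : 0 ≤ (Q - q : ℝ) * a ^ 2 := by nlinarith [sq_nonneg a]
      apply div_pos <;> linarith, ?_⟩
    have h0 : 0 ≤ (Q - q : ℝ) * a ^ 2 := by nlinarith [sq_nonneg a]
    have : (Q - q : ℝ) * a ^ 2 * ((1 - (q - 1) * b ^ 2) / ((Q - q) * a ^ 2 + 1)) <
        1 - (q - 1) * b ^ 2 := by
      rw [← mul_div_assoc, div_lt_iff₀ (by linarith)]
      nlinarith
    linarith
  set u := treeFn S p d b a with hu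
  set H : V → ℝ := fun x => (if x ∈ S then 1 else k) * u x ^ 2 with hHdef
  have hH : ∀ x, 0 ≤ H x := fun x => by
    simp only [hHdef]; split_ifs <;> positivity
  set r := max ((q - 1) * b ^ 2 + (Q - q) * a ^ 2 * k) ((Q - 1) * a ^ 2) with hr
  have hsum : Summable H := by
    have hC : ∀ x, ∑ y ∈ C x, H y = (C x).card * b ^ 2 * u x ^ 2 := by
      intro x
      have : ∀ y ∈ C x, H y = b ^ 2 * u x ^ 2 := fun y hy => by
        simp only [hHdef]
        rw [if_pos ((T.mem_inner x y).1 hy).2.2, hu, T.treeFn_inner b a hy]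
        ring
      rw [Finset.sum_congr rfl this]; simp [mul_assoc]
    have hD : ∀ x, ∑ y ∈ D x, H y = (D x).card * a ^ 2 * k * u x ^ 2 := by
      intro x
      have : ∀ y ∈ D x, H y = a ^ 2 * k * u x ^ 2 := fun y hy => by
        simp only [hHdef]
        rw [if_neg ((T.mem_outer x y).1 hy).2.2, hu, T.treeFn_outer b a hy]
        ring
      rw [Finset.sum_congr rfl this]; simp [mul_assoc]
    have hr0 : 0 ≤ r := le_trans (by nlinarith [sq_nonneg a]) (le_max_right _ _)
    refine T.summable_of_children (r := r) (e := q * b ^ 2 + Q * a ^ 2 * k) hH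
      hr0 (max_lt hk ha1) (by positivity) fun x => ?_
    rw [Finset.sum_union (T.disjoint_inner_outer x), hC, hD]
    by_cases hx : x ∈ S
    · have e1 : ((D x).card : ℝ) = Q - q := by
        rw [← T.card_outer x hx]; push_cast; ring
      by_cases hxr : x = root
      · subst hxr
        have := hH x
        simp only [if_true, hu, T.treeFn_root, T.card_inner_root, e1]
        have : 0 ≤ (q : ℝ) * a ^ 2 * k := by positivity
        nlinarith [mul_nonneg hr0 (hH x)]
      · have e2 : ((C x).card : ℝ) = q - 1 := by
          rw [← T.card_inner x hx hxr]; push_cast; ring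
        simp only [hHdef, hx, if_true, hxr, if_false, e1, e2]
        have := le_max_left ((q - 1) * b ^ 2 + (Q - q) * a ^ 2 * k) ((Q - 1 : ℝ) * a ^ 2)
        rw [← hr] at this
        nlinarith [mul_le_mul_of_nonneg_right this (sq_nonneg (u x))]
    · have hxr : x ≠ root := fun h => hx (h ▸ T.root_mem)
      have e1 : ((D x).card : ℝ) = Q - 1 := by
        rw [← T.card_outer_of_notMem x hx]; push_cast; ring
      simp only [hHdef, hx, hxr, if_false, e1, T.inner_eq_empty hx]
      have := le_max_right ((q - 1) * b ^ 2 + (Q - q) * a ^ 2 * k) ((Q - 1 : ℝ) * a ^ 2)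
      rw [← hr] at this
      simp
      nlinarith [mul_le_mul_of_nonneg_right this (mul_nonneg hk0.le (sq_nonneg (u x)))]
  refine Summable.of_nonneg_of_le (fun x => sq_nonneg _) (fun x => ?_)
    (hsum.mul_left (max 1 k⁻¹))
  simp only [hHdef]
  split_ifs with h
  · nlinarith [le_max_left 1 k⁻¹, sq_nonneg (u x)]
  · have : 1 ≤ max 1 k⁻¹ * k := by
      calc 1 = k⁻¹ * k := by field_simp
        _ ≤ _ := by gcongr; exact le_max_right _ _
    nlinarith [sq_nonneg (u x)]

/-- The squared mass on `S` blows up as `(q - 1) b²` increases to `1`. -/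
theorem one_le_tsum_treeFn_sq (T : RootedSubtree S root p d C D q Q) (hq : 1 ≤ q)
    {b a : ℝ} (hs : Summable fun x => treeFn S p d b a x ^ 2) :
    1 ≤ (1 - (q - 1) * b ^ 2) * ∑' x, if x ∈ S then treeFn S p d b a x ^ 2 else 0 := by
  set u := treeFn S p d b a with hu
  set g : V → ℝ := fun x => if x ∈ S then u x ^ 2 else 0 with hg
  have hg0 : ∀ x, 0 ≤ g x := fun x => by simp only [hg]; split_ifs <;> positivity
  have hgs : Summable g := Summable.of_nonneg_of_le hg0
    (fun x => by simp only [hg]; split_ifs <;> [exact le_rfl; positivity]) hs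
  have hq' : (1 : ℝ) ≤ q := by exact_mod_cast hq
  have hC : ∀ x, (q - 1) * b ^ 2 * g x ≤ ∑ y ∈ C x, g y := by
    intro x
    by_cases hx : x ∈ S
    · have h1 : ∀ y ∈ C x, g y = b ^ 2 * g x := fun y hy => by
        simp only [hg]
        rw [if_pos ((T.mem_inner x y).1 hy).2.2, if_pos hx, hu, T.treeFn_inner b a hy]
        ring
      rw [Finset.sum_congr rfl h1, Finset.sum_const, nsmul_eq_mul, mul_assoc]
      refine mul_le_mul_of_nonneg_right ?_ (mul_nonneg (sq_nonneg b) (hg0 x))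
      by_cases hxr : x = root
      · subst hxr
        rw [T.card_inner_root]; linarith
      · rw [← T.card_inner x hx hxr]; push_cast; linarith
    · simp [T.inner_eq_empty hx, hg, hx]
  have hF : ∀ F : Finset V, 1 + (q - 1) * b ^ 2 * ∑ x ∈ F, g x ≤ ∑' x, g x := by
    intro F
    have hdisj : Set.PairwiseDisjoint (F : Set V) C := fun x _ y _ hxy =>
      Finset.disjoint_left.2 fun z hz hz' =>
        hxy (((T.mem_inner x z).1 hz).2.1.symm.trans ((T.mem_inner y z).1 hz').2.1)
    have hroot : root ∉ F.biUnion C := fun h => by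
      obtain ⟨x, _, hx⟩ := Finset.mem_biUnion.1 h
      exact ((T.mem_inner x root).1 hx).1 rfl
    have h1 : ∑ x ∈ insert root (F.biUnion C), g x ≤ ∑' x, g x :=
      hgs.sum_le_tsum _ fun x _ => hg0 x
    rw [Finset.sum_insert hroot, Finset.sum_biUnion hdisj] at h1
    have h2 : g root = 1 := by simp [hg, T.root_mem, hu, T.treeFn_root]
    rw [h2] at h1
    refine le_trans ?_ h1
    rw [Finset.mul_sum]
    gcongr with x _
    exact hC x
  have hlim : Tendsto (fun F : Finset V => 1 + (q - 1) * b ^ 2 * ∑ x ∈ F, g x) atTop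
      (𝓝 (1 + (q - 1) * b ^ 2 * ∑' x, g x)) :=
    (hgs.hasSum.const_mul _).const_add _
  have := le_of_tendsto' hlim hF
  linarith

end RootedSubtree

section Operators

variable {V : Type}

theorem L2.norm_sq_eq_tsum (f : L2 V) : ‖f‖ ^ 2 = ∑' x, ‖f x‖ ^ 2 := by
  have := lp.norm_rpow_eq_tsum (p := 2) (by norm_num) f
  simpa using this

theorem L2.summable_norm_sq (f : L2 V) : Summable fun x => ‖f x‖ ^ 2 := by
  have := (lp.memℓp f).summable (p := 2) (by norm_num)
  simpa using this

theorem L2.norm_le_of_sum_le {f : L2 V} {c : ℝ} (hc : 0 ≤ c)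
    (h : ∀ F : Finset V, ∑ x ∈ F, ‖f x‖ ^ 2 ≤ c ^ 2) : ‖f‖ ≤ c :=
  lp.norm_le_of_forall_sum_le (p := 2) (by norm_num) hc fun F => by simpa using h F

/-- The element of `ℓ²(V)` given by a square-summable real function. -/
def L2.ofReal (u : V → ℝ) (hu : Summable fun x => u x ^ 2) : L2 V :=
  ⟨fun x => (u x : ℂ), memℓp_gen (by simpa using hu)⟩

theorem L2.ofReal_apply (u : V → ℝ) (hu : Summable fun x => u x ^ 2) (x : V) :
    L2.ofReal u hu x = (u x : ℂ) := rfl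

theorem delta_apply (x y : V) : delta x y = if y = x then 1 else 0 := by
  simp only [delta, lp.single_apply, Pi.single_apply]

/-- A bounded operator acts through its matrix entries. -/
theorem hasSum_entry (B : L2 V →L[ℂ] L2 V) (f : L2 V) (x : V) :
    HasSum (fun y => f y * entry B x y) (B f x) := by
  have h1 : HasSum (fun y => f y • delta y) f := by
    have := lp.hasSum_single (p := 2) (by norm_num) f
    convert this using 2 with y
    ext z
    simp [delta_apply, lp.single_apply, Pi.single_apply]
  have h2 := ((lp.evalCLM ℂ (fun _ : V => ℂ) 2 x) ∘L B).hasSum h1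
  simp only [map_smul, smul_eq_mul] at h2
  exact h2

/-- `B` is the adjacency operator of the locally finite graph with neighbourhoods `N`, plus the
multiplication by the nonnegative function `s`. -/
structure IsLoopedAdjacency (B : L2 V →L[ℂ] L2 V) (N : V → Finset V) (s : V → ℝ) : Prop where
  symm : ∀ x y, y ∈ N x → x ∈ N y
  nonneg : ∀ x, 0 ≤ s x
  apply_eq : ∀ (f : L2 V) (x : V), B f x = ∑ y ∈ N x, f y + s x * f x

/-- Schur's test: a positive supersolution bounds the norm. -/
theorem IsLoopedAdjacency.norm_le {B : L2 V →L[ℂ] L2 V} {N : V → Finset V} {s : V → ℝ}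
    (hB : IsLoopedAdjacency B N s) {u : V → ℝ} (hu : ∀ x, 0 < u x) {l : ℝ} (hl : 0 ≤ l)
    (hsup : ∀ x, ∑ y ∈ N x, u y + s x * u x ≤ l * u x) : ‖B‖ ≤ l := by
  refine B.opNorm_le_bound hl fun f => L2.norm_le_of_sum_le (by positivity) fun F => ?_
  set h : V → ℝ := fun y => ‖f y‖ ^ 2 / u y with hh
  have hh0 : ∀ y, 0 ≤ h y := fun y => div_nonneg (sq_nonneg _) (hu y).le
  have hhu : ∀ y, h y * u y = ‖f y‖ ^ 2 := fun y => div_mul_cancel₀ _ (hu y).ne'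
  have hpt : ∀ x, ‖B f x‖ ^ 2 ≤ l * u x * (∑ y ∈ N x, h y + s x * h x) := by
    intro x
    have hs := hB.nonneg x
    have h1 : ‖B f x‖ ≤ ∑ y ∈ N x, ‖f y‖ + s x * ‖f x‖ := by
      rw [hB.apply_eq]
      refine (norm_add_le _ _).trans (add_le_add (norm_sum_le _ _) ?_)
      rw [norm_mul, Complex.norm_real, Real.norm_of_nonneg hs]
    have h2 : (∑ y ∈ N x, ‖f y‖ + s x * ‖f x‖) ^ 2 ≤
        (∑ y ∈ N x, u y + s x * u x) * (∑ y ∈ N x, h y + s x * h x) := by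
      have := Finset.sum_sq_le_sum_mul_sum_of_sq_le_mul (Finset.insertNone (N x))
        (r := fun o => o.elim (s x * ‖f x‖) fun y => ‖f y‖)
        (f := fun o => o.elim (s x * u x) fun y => u y)
        (g := fun o => o.elim (s x * h x) fun y => h y)
        (fun o _ => by cases o with
          | none => exact mul_nonneg hs (hu x).le
          | some y => exact (hu y).le)
        (fun o _ => by cases o with
          | none => exact mul_nonneg hs (hh0 x)
          | some y => exact hh0 y)
        (fun o _ => by cases o with
          | none => simp only [Option.elim]; rw [mul_pow, ← hhu]; exact le_of_eq (by ring)
          | some y => simp only [Option.elim]; rw [← hhu]; exact le_of_eq (by ring))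
      simpa [Finset.sum_insertNone, add_comm] using this
    refine (pow_le_pow_left₀ (norm_nonneg _) h1 2).trans (h2.trans ?_)
    refine mul_le_mul_of_nonneg_right (hsup x) ?_
    exact add_nonneg (Finset.sum_nonneg fun y _ => hh0 y) (mul_nonneg hs (hh0 x))
  set U := F ∪ F.biUnion N with hU
  have hswap : ∑ x ∈ F, u x * (∑ y ∈ N x, h y + s x * h x) ≤
      ∑ y ∈ U, h y * (∑ x ∈ N y, u x + s y * u y) := by
    have e1 : ∑ x ∈ F, u x * ∑ y ∈ N x, h y ≤ ∑ y ∈ U, h y * ∑ x ∈ N y, u x := by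
      simp only [Finset.mul_sum]
      have : ∑ x ∈ F, ∑ y ∈ N x, u x * h y =
          ∑ y ∈ U, ∑ x ∈ F with y ∈ N x, u x * h y := by
        refine Finset.sum_comm' fun x y => ?_
        simp only [hU, Finset.mem_union, Finset.mem_biUnion, Finset.mem_filter]
        exact ⟨fun ⟨h1, h2⟩ => ⟨⟨h1, h2⟩, Or.inr ⟨x, h1, h2⟩⟩, fun h => h.1⟩
      rw [this]
      refine Finset.sum_le_sum fun y _ => ?_
      refine (Finset.sum_le_sum_of_subset_of_nonneg (t := N y) ?_ ?_).trans_eq ?_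
      · intro x hx
        exact hB.symm x y (Finset.mem_filter.1 hx).2
      · exact fun x _ _ => mul_nonneg (hu x).le (hh0 y)
      · exact Finset.sum_congr rfl fun x _ => mul_comm _ _
    have e2 : ∑ x ∈ F, u x * (s x * h x) ≤ ∑ y ∈ U, h y * (s y * u y) := by
      refine (Finset.sum_le_sum_of_subset_of_nonneg (t := U) Finset.subset_union_left ?_).trans_eq
        (Finset.sum_congr rfl fun x _ => by ring)
      exact fun x _ _ => mul_nonneg (hu x).le (mul_nonneg (hB.nonneg x) (hh0 x))
    simp only [mul_add, Finset.sum_add_distrib]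
    exact add_le_add e1 e2
  calc ∑ x ∈ F, ‖B f x‖ ^ 2 ≤ ∑ x ∈ F, l * (u x * (∑ y ∈ N x, h y + s x * h x)) :=
        Finset.sum_le_sum fun x _ => (hpt x).trans_eq (by ring)
    _ = l * ∑ x ∈ F, u x * (∑ y ∈ N x, h y + s x * h x) := by rw [Finset.mul_sum]
    _ ≤ l * ∑ y ∈ U, h y * (∑ x ∈ N y, u x + s y * u y) := by gcongr
    _ ≤ l * ∑ y ∈ U, h y * (l * u y) := by
        gcongr with y _
        · exact hh0 y
        · exact hsup y
    _ = l ^ 2 * ∑ y ∈ U, ‖f y‖ ^ 2 := by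
        simp only [← hhu, Finset.mul_sum]
        exact Finset.sum_congr rfl fun y _ => by ring
    _ ≤ l ^ 2 * ‖f‖ ^ 2 := by
        rw [L2.norm_sq_eq_tsum]
        gcongr
        exact (L2.summable_norm_sq f).sum_le_tsum _ fun x _ => sq_nonneg _
    _ = (l * ‖f‖) ^ 2 := by ring

theorem IsAdjacencyOp.isLoopedAdjacency {G : SimpleGraph V} {A : L2 V →L[ℂ] L2 V}
    (hA : IsAdjacencyOp G A) {N : V → Finset V} (hN : ∀ x y, G.Adj x y ↔ y ∈ N x) :
    IsLoopedAdjacency A N 0 where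
  symm x y h := (hN y x).1 ((hN x y).2 h).symm
  nonneg x := le_rfl
  apply_eq f x := by
    have h1 := hasSum_entry A f x
    have h2 : HasSum (fun y => f y * entry A x y) (∑ y ∈ N x, f y * entry A x y) :=
      hasSum_sum_of_ne_finset_zero fun y hy => by
        rw [hA x y, if_neg (fun h => hy ((hN x y).1 h)), mul_zero]
    rw [h1.unique h2]
    simp only [Pi.zero_apply, Complex.ofReal_zero, zero_mul, add_zero]
    exact Finset.sum_congr rfl fun y hy => by rw [hA x y, if_pos ((hN x y).2 hy), mul_one]

theorem IsLoopedAdjacency.add_proj {A : L2 V →L[ℂ] L2 V} {N : V → Finset V}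
    (hA : IsLoopedAdjacency A N 0) {P : Set V → (L2 V →L[ℂ] L2 V)} (hP : IsProjFamily P)
    (S : Set V) : IsLoopedAdjacency (A + P S) N fun x => if x ∈ S then 1 else 0 where
  symm := hA.symm
  nonneg x := by split_ifs <;> norm_num
  apply_eq f x := by
    have h : ((A + P S) f : ∀ _ : V, ℂ) x = A f x + P S f x := rfl
    rw [h, hA.apply_eq, hP]
    split_ifs <;> simp

end Operators

/-- The corner inverse and the Krein formula for the compression of a resolvent. -/
theorem exists_cornerInverse {V : Type} (A P : L2 V →L[ℂ] L2 V) (hP : P * P = P) (l : ℝ)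
    (hA : IsUnit ((l : ℂ) • (1 : L2 V →L[ℂ] L2 V) - A))
    (hAP : IsUnit ((l : ℂ) • (1 : L2 V →L[ℂ] L2 V) - (A + P))) :
    ∃ M : L2 V →L[ℂ] L2 V, IsCornerInverse P M (ResR A l) ∧
      ResR (A + P) l = ResR A l ∘L ((1 : L2 V →L[ℂ] L2 V) + M ∘L ResR A l) := by
  have hX1 := Ring.mul_inverse_cancel _ hA
  have hX2 := Ring.inverse_mul_cancel _ hA
  have hY1 := Ring.mul_inverse_cancel _ hAP
  have hY2 := Ring.inverse_mul_cancel _ hAP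
  change _ * ResR A l = 1 at hX1
  change ResR A l * _ = 1 at hX2
  change _ * ResR (A + P) l = 1 at hY1
  change ResR (A + P) l * _ = 1 at hY2
  set R := ResR A l
  set R' := ResR (A + P) l
  set X := (l : ℂ) • (1 : L2 V →L[ℂ] L2 V) - A
  have hY : (l : ℂ) • (1 : L2 V →L[ℂ] L2 V) - (A + P) = X - P := by simp only [X]; abel
  rw [hY] at hY1 hY2
  have e1 : R' = R + R * P * R' := by
    have : R * ((X - P) * R') = R := by rw [hY1, mul_one]
    calc R' = (R * X) * R' := by rw [hX2, one_mul]
      _ = R * ((X - P) * R') + R * P * R' := by noncomm_ring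
      _ = _ := by rw [this]
  have e2 : R' = R + R' * P * R := by
    have : R' * (X - P) * R = R := by rw [hY2, one_mul]
    calc R' = R' * (X * R) := by rw [hX1, mul_one]
      _ = R' * (X - P) * R + R' * P * R := by noncomm_ring
      _ = _ := by rw [this]
  have e1' : R * P * R' = R' - R := eq_sub_of_add_eq' e1.symm
  have e2' : R' * P * R = R' - R := eq_sub_of_add_eq' e2.symm
  refine ⟨P + P * R' * P, ⟨?_, ?_, ?_, ?_⟩, ?_⟩
  · change P * (P + P * R' * P) = _
    rw [mul_add, mul_assoc P R' P, ← mul_assoc P P, hP]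
  · change (P + P * R' * P) * P = _
    rw [add_mul, mul_assoc _ P P, hP]
  · change (P + P * R' * P) * (P - P * (R * P)) = P
    calc (P + P * R' * P) * (P - P * (R * P))
        = P * P - (P * P) * R * P + P * R' * (P * P) - P * (R' * (P * P) * R) * P := by
          noncomm_ring
      _ = P := by rw [hP, e2']; noncomm_ring
  · change (P - P * (R * P)) * (P + P * R' * P) = P
    calc (P - P * (R * P)) * (P + P * R' * P)
        = P * P + (P * P) * R' * P - P * R * (P * P) - P * (R * (P * P) * R') * P := by
          noncomm_ring
      _ = P := by rw [hP, e1']; noncomm_ring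
  · change R' = R * (1 + (P + P * R' * P) * R)
    calc R' = R + R * P * R' := e1
      _ = R + R * P * (R + R' * P * R) := by rw [← e2]
      _ = _ := by noncomm_ring

section Scalars

theorem aF_spec {Q : ℕ} (hQ : 1 < Q) {l : ℝ} (hl : 2 * √((Q : ℝ) - 1) < l) :
    0 < aF Q l ∧ l = 1 / aF Q l + (Q - 1) * aF Q l ∧ (Q - 1) * aF Q l ^ 2 < 1 := by
  have hm : (0 : ℝ) < Q - 1 := by
    have : (1 : ℝ) < Q := by exact_mod_cast hQ
    linarith
  have hl0 : 0 < l := lt_of_le_of_lt (by positivity) hl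
  have hsq : 4 * ((Q : ℝ) - 1) < l ^ 2 := by
    have h1 := Real.sq_sqrt hm.le
    have h2 := Real.sqrt_nonneg ((Q : ℝ) - 1)
    nlinarith
  have h1 : 0 < 1 - 4 * ((Q : ℝ) - 1) / l ^ 2 := by
    rw [sub_pos, div_lt_one (by positivity)]; exact hsq
  have h2 : 1 - 4 * ((Q : ℝ) - 1) / l ^ 2 < 1 := by
    have : 0 < 4 * ((Q : ℝ) - 1) / l ^ 2 := by positivity
    linarith
  set s := √(1 - 4 * ((Q : ℝ) - 1) / l ^ 2) with hs
  have hs0 : 0 < s := Real.sqrt_pos.2 h1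
  have hss : s ^ 2 = 1 - 4 * ((Q : ℝ) - 1) / l ^ 2 := Real.sq_sqrt h1.le
  have hs1 : s < 1 := by nlinarith
  have hss' : l ^ 2 * s ^ 2 = l ^ 2 - 4 * (Q - 1) := by rw [hss]; field_simp
  have ha : aF Q l = l * (1 - s) / (2 * (Q - 1)) := rfl
  have ha0 : 0 < aF Q l := by
    rw [ha]; apply div_pos <;> nlinarith
  have ha2 : 2 * (Q - 1) * aF Q l = l * (1 - s) := by rw [ha]; field_simp
  have hquad : (Q - 1) * aF Q l ^ 2 - l * aF Q l + 1 = 0 := by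
    have h3 : 4 * (Q - 1) * ((Q - 1) * aF Q l ^ 2 - l * aF Q l + 1) = 0 := by
      calc 4 * (Q - 1) * ((Q - 1) * aF Q l ^ 2 - l * aF Q l + 1)
          = (2 * (Q - 1) * aF Q l) ^ 2 - 2 * l * (2 * (Q - 1) * aF Q l) + 4 * (Q - 1) := by ring
        _ = l ^ 2 * s ^ 2 - l ^ 2 + 4 * (Q - 1) := by rw [ha2]; ring
        _ = 0 := by rw [hss']; ring
    rcases mul_eq_zero.1 h3 with h | h
    · linarith
    · exact h
  refine ⟨ha0, ?_, ?_⟩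
  · field_simp
    linarith
  · have : 2 * (Q - 1) * aF Q l < l := by rw [ha2]; nlinarith
    nlinarith

theorem aF_two_sqrt {q : ℕ} (hq : 1 < q) :
    aF q (2 * √((q : ℝ) - 1)) = 1 / √((q : ℝ) - 1) := by
  have hm : (0 : ℝ) < q - 1 := by
    have : (1 : ℝ) < q := by exact_mod_cast hq
    linarith
  have h1 := Real.sq_sqrt hm.le
  have h2 := Real.sqrt_pos.2 hm
  have h3 : 1 - 4 * ((q : ℝ) - 1) / (2 * √((q : ℝ) - 1)) ^ 2 = 0 := by
    rw [mul_pow, h1]; field_simp; norm_num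
  rw [aF, h3, Real.sqrt_zero, div_eq_div_iff (by positivity) h2.ne']
  linarith

theorem continuousAt_aF (Q : ℕ) {l : ℝ} (hl : l ≠ 0) : ContinuousAt (aF Q) l := by
  unfold aF
  have : l ^ 2 ≠ 0 := pow_ne_zero 2 hl
  fun_prop (disch := assumption)

theorem aF_lt_aF {Q : ℕ} (hQ : 1 < Q) {l m : ℝ} (hl : 2 * √((Q : ℝ) - 1) < l) (hlm : l < m) :
    aF Q m < aF Q l := by
  obtain ⟨h1, h2, h3⟩ := aF_spec hQ hl
  obtain ⟨h1', h2', h3'⟩ := aF_spec hQ (hl.trans hlm)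
  set a := aF Q l
  set b := aF Q m
  have hQ' : (1 : ℝ) < Q := by exact_mod_cast hQ
  by_contra! h
  have h4 : (Q - 1) * (a * b) < 1 := by nlinarith
  have h5 : (m - l) * (a * b) = (a - b) * (1 - (Q - 1) * (a * b)) := by
    rw [h2, h2']; field_simp; ring
  nlinarith [mul_pos (sub_pos.2 hlm) (mul_pos h1 h1')]

end Scalars

section Norm

variable {V : Type} {S : Set V} {root : V} {p : V → V} {d : V → ℕ} {C D : V → Finset V} {q Q : ℕ}

/-- The neighbours of a vertex: its children, and its parent unless it is the root. -/
def nbr (root : V) (p : V → V) (C D : V → Finset V) (x : V) : Finset V :=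
  if x = root then C x ∪ D x else insert (p x) (C x ∪ D x)

/-- The multiplication part of `A + P S`. -/
def loops (S : Set V) (x : V) : ℝ := if x ∈ S then 1 else 0

theorem mem_nbr (x y : V) :
    y ∈ nbr root p C D x ↔ y ∈ C x ∨ y ∈ D x ∨ (x ≠ root ∧ y = p x) := by
  unfold nbr
  split_ifs with h <;> simp [h]
  tauto

theorem RootedSubtree.sum_nbr (T : RootedSubtree S root p d C D q Q) (F : V → ℝ) (x : V) :
    ∑ y ∈ nbr root p C D x, F y =
      ∑ y ∈ C x, F y + ∑ y ∈ D x, F y + if x = root then 0 else F (p x) := by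
  unfold nbr
  split_ifs with h
  · rw [Finset.sum_union (T.disjoint_inner_outer x), add_zero]
  · rw [Finset.sum_insert (T.parent_notMem h), Finset.sum_union (T.disjoint_inner_outer x),
      add_comm]

theorem RootedSubtree.sum_nbr_eq (T : RootedSubtree S root p d C D q Q) {b a : ℝ} (hb : 0 < b)
    (ha : 0 < a) (x : V) :
    ∑ y ∈ nbr root p C D x, treeFn S p d b a y =
      eigenFactor S root q Q b a x * treeFn S p d b a x := by
  rw [T.sum_nbr, T.sum_nbr_treeFn hb ha]

theorem RootedSubtree.adjacency_norm_le (T : RootedSubtree S root p d C D q Q) (hQ : 2 ≤ Q)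
    {A : L2 V →L[ℂ] L2 V} (hA : IsLoopedAdjacency A (nbr root p C D) 0) :
    ‖A‖ ≤ 2 * √((Q : ℝ) - 1) := by
  have hQ' : (2 : ℝ) ≤ Q := by exact_mod_cast hQ
  have hR : 0 < √((Q : ℝ) - 1) := Real.sqrt_pos.2 (by linarith)
  have hRR : √((Q : ℝ) - 1) ^ 2 = Q - 1 := Real.sq_sqrt (by linarith)
  set R := √((Q : ℝ) - 1)
  have hc : 0 < 1 / R := by positivity
  refine hA.norm_le (u := treeFn S p d (1 / R) (1 / R))
    (fun x => RootedSubtree.treeFn_pos S p d hc hc x) (by positivity) fun x => ?_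
  rw [T.sum_nbr_eq hc hc, Pi.zero_apply, zero_mul, add_zero]
  refine mul_le_mul_of_nonneg_right ?_ (RootedSubtree.treeFn_pos S p d hc hc x).le
  have e : (Q - 1) * (1 / R) = R := by rw [← hRR]; field_simp
  have e1 : 1 / (1 / R) = R := by simp
  unfold eigenFactor
  split_ifs
  · have : 1 / R ≤ R := by
      rw [div_le_iff₀ hR]; nlinarith
    linarith
  · rw [e1]; linarith
  · rw [e1]; linarith

theorem RootedSubtree.norm_le (T : RootedSubtree S root p d C D q Q) (hq : 2 ≤ q) (hqQ : q ≤ Q)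
    {B : L2 V →L[ℂ] L2 V} (hB : IsLoopedAdjacency B (nbr root p C D) (loops S)) {b : ℝ}
    (hb : 0 < b) (h : 2 * √((q : ℝ) - 1) ≤ 1 / b - 1 + (q - 1) * b) :
    ‖B‖ ≤ 1 / b + (Q - 1) * b := by
  have hq' : (2 : ℝ) ≤ q := by exact_mod_cast hq
  have hQ' : (q : ℝ) ≤ Q := by exact_mod_cast hqQ
  have hr : 0 < √((q : ℝ) - 1) := Real.sqrt_pos.2 (by linarith)
  have hrr : √((q : ℝ) - 1) ^ 2 = q - 1 := Real.sq_sqrt (by linarith)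
  set r := √((q : ℝ) - 1)
  have hc : 0 < 1 / r := by positivity
  have hb' : 0 < 1 / b := by positivity
  refine hB.norm_le (u := treeFn S p d (1 / r) b)
    (fun x => RootedSubtree.treeFn_pos S p d hc hb x)
    (add_nonneg hb'.le (mul_nonneg (by linarith) hb.le)) fun x => ?_
  rw [T.sum_nbr_eq hc hb, ← add_mul]
  refine mul_le_mul_of_nonneg_right ?_ (RootedSubtree.treeFn_pos S p d hc hb x).le
  have e : (q - 1) * (1 / r) = r := by rw [← hrr]; field_simp
  have e1 : 1 / (1 / r) = r := by simp
  have e2 : 1 / r ≤ r := by rw [div_le_iff₀ hr]; nlinarith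
  unfold eigenFactor loops
  split_ifs with h1 h2 h2
  · linarith
  · exact absurd (h1 ▸ T.root_mem) h2
  · rw [e1]; linarith
  · linarith

theorem RootedSubtree.apply_treeFn (T : RootedSubtree S root p d C D q Q)
    {B : L2 V →L[ℂ] L2 V} (hB : IsLoopedAdjacency B (nbr root p C D) (loops S)) {b a : ℝ}
    (hb : 0 < b) (ha : 0 < a) (hs : Summable fun x => treeFn S p d b a x ^ 2) (x : V) :
    B (L2.ofReal _ hs) x =
      (((eigenFactor S root q Q b a x + loops S x) * treeFn S p d b a x : ℝ) : ℂ) := by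
  rw [hB.apply_eq, add_mul, ← T.sum_nbr_eq hb ha]
  simp [L2.ofReal_apply]

theorem RootedSubtree.two_sqrt_le (T : RootedSubtree S root p d C D q Q) (hq : 2 ≤ q)
    (hqQ : q ≤ Q) {B : L2 V →L[ℂ] L2 V} (hB : IsLoopedAdjacency B (nbr root p C D) (loops S))
    {a : ℝ} (ha : 0 < a) (ha1 : (Q - 1) * a ^ 2 < 1) (hl : ‖B‖ = 1 / a + (Q - 1) * a) :
    2 * √((q : ℝ) - 1) ≤ 1 / a - 1 + (q - 1) * a := by
  have hq' : (2 : ℝ) ≤ q := by exact_mod_cast hq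
  have hQ' : (q : ℝ) ≤ Q := by exact_mod_cast hqQ
  have hrr : √((q : ℝ) - 1) ^ 2 = q - 1 := Real.sq_sqrt (by linarith)
  have hr : 0 < √((q : ℝ) - 1) := Real.sqrt_pos.2 (by linarith)
  set r := √((q : ℝ) - 1)
  by_contra! hlt
  have ha' : 0 < 1 / a := by positivity
  have hm : 0 ≤ (Q - 1) * a := mul_nonneg (by linarith) ha.le
  set l := ‖B‖ with hldef
  have hl0 : 0 < l := by rw [hl]; linarith
  obtain ⟨e, he, hel⟩ : ∃ e > 0, 2 * r = l - 1 - (Q - q) * a + e :=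
    ⟨2 * r - (l - 1 - (Q - q) * a), by rw [hl]; linarith, by ring⟩
  set K := l ^ 2 + 2 * l * e with hK
  have hle : 0 < l * e := mul_pos hl0 he
  have hK0 : 0 < K := by positivity
  set t := l * e / K with ht
  have ht0 : 0 < t := by positivity
  have htK : K * t = l * e := by rw [ht]; field_simp
  have ht1 : t < 1 := by rw [ht, div_lt_one hK0]; nlinarith
  set b := √((1 - t) / (q - 1)) with hbdef
  have hb : 0 < b := Real.sqrt_pos.2 (div_pos (by linarith) (by linarith))
  have hbb : (q - 1) * b ^ 2 = 1 - t := by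
    rw [hbdef, Real.sq_sqrt (div_pos (by linarith) (by linarith)).le]
    have : (q - 1 : ℝ) ≠ 0 := by linarith
    field_simp
  have hs := T.summable_treeFn_sq hqQ (by omega) hb ha (by linarith) ha1
  have hT := T.one_le_tsum_treeFn_sq (by omega) hs
  rw [hbb, sub_sub_cancel] at hT
  have hBf : ‖B (L2.ofReal _ hs)‖ ^ 2 ≤ l ^ 2 * ‖L2.ofReal _ hs‖ ^ 2 := by
    rw [← mul_pow]
    exact pow_le_pow_left₀ (norm_nonneg _) (B.le_opNorm _) 2
  have hsB := L2.summable_norm_sq (B (L2.ofReal _ hs))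
  rw [L2.norm_sq_eq_tsum, L2.norm_sq_eq_tsum] at hBf
  simp only [T.apply_treeFn hB hb ha hs] at hBf hsB
  simp only [L2.ofReal_apply, Complex.norm_real, Real.norm_eq_abs, sq_abs] at hBf hsB
  set u := treeFn S p d b a with hu
  set g : V → ℝ := fun x => if x ∈ S then u x ^ 2 else 0 with hg
  have hgs : Summable g := Summable.of_nonneg_of_le
    (fun x => by simp only [hg]; split_ifs <;> positivity)
    (fun x => by simp only [hg]; split_ifs <;> [exact le_rfl; positivity]) hs
  have hamgm : 2 * r ≤ 1 / b + (q - 1) * b := by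
    have : 1 / b + (q - 1) * b - 2 * r = (1 - r * b) ^ 2 / b := by
      rw [← hrr]; field_simp; ring
    have h2 : 0 ≤ (1 - r * b) ^ 2 / b := by positivity
    linarith
  have hpt : ∀ x, l ^ 2 * u x ^ 2 + 2 * l * e * g x ≤
      ((eigenFactor S root q Q b a x + loops S x) * u x) ^ 2 + if x = root then K else 0 := by
    intro x
    rw [mul_pow]
    by_cases hx : x = root
    · have hu1 : u x = 1 := by rw [hx]; exact T.treeFn_root b a
      have hxS : x ∈ S := hx ▸ T.root_mem
      simp only [hg, if_pos hx, if_pos hxS, hu1, one_pow, mul_one]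
      linarith [sq_nonneg (eigenFactor S root q Q b a x + loops S x)]
    · by_cases hxS : x ∈ S
      · simp only [hg, eigenFactor, loops, if_neg hx, if_pos hxS, add_zero]
        rw [← add_mul]
        refine mul_le_mul_of_nonneg_right ?_ (sq_nonneg _)
        have h3 : l + e ≤ 1 / b + (q - 1) * b + (Q - q) * a + 1 := by linarith
        have := pow_le_pow_left₀ (by positivity) h3 2
        nlinarith [sq_nonneg e]
      · simp only [hg, eigenFactor, loops, if_neg hx, if_neg hxS, add_zero, mul_zero]
        rw [hl]
  have hroot : HasSum (fun x => if x = root then K else 0) K := hasSum_ite_eq root K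
  have hsum := Summable.tsum_le_tsum hpt ((hs.mul_left _).add (hgs.mul_left _))
    (hsB.add hroot.summable)
  rw [(hs.mul_left _).tsum_add (hgs.mul_left _), hsB.tsum_add hroot.summable, hroot.tsum_eq,
    tsum_mul_left, tsum_mul_left] at hsum
  have h5 : 2 * (l * e) * (∑' x, g x) ≤ K := by linarith
  nlinarith

theorem RootedSubtree.le_two_sqrt (T : RootedSubtree S root p d C D q Q) (hq : 2 ≤ q)
    (hqQ : q ≤ Q) {B : L2 V →L[ℂ] L2 V} (hB : IsLoopedAdjacency B (nbr root p C D) (loops S))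
    {a : ℝ} (ha : 0 < a) (ha1 : (Q - 1) * a ^ 2 < 1) (hl : ‖B‖ = 1 / a + (Q - 1) * a) :
    1 / a - 1 + (q - 1) * a ≤ 2 * √((q : ℝ) - 1) := by
  by_contra! hlt
  have hc1 : ContinuousAt (fun b : ℝ => 1 / b - 1 + (q - 1) * b) a := by
    fun_prop (disch := exact ha.ne')
  have hc2 : ContinuousAt (fun b : ℝ => (Q - 1) * (a * b)) a := by fun_prop
  have h1 := hc1.eventually (lt_mem_nhds hlt)
  have h2 := hc2.eventually (gt_mem_nhds (show (Q - 1) * (a * a) < 1 by rwa [← sq]))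
  obtain ⟨b, ⟨hb1, hb2⟩, hab⟩ := (((h1.and h2).filter_mono nhdsWithin_le_nhds).and
    (self_mem_nhdsWithin : Ioi a ∈ 𝓝[>] a)).exists
  have hab : a < b := hab
  have hb := ha.trans hab
  have h3 := T.norm_le hq hqQ hB hb hb1.le
  have h4 : (1 / a + (Q - 1) * a - (1 / b + (Q - 1) * b)) * (a * b) =
      (b - a) * (1 - (Q - 1) * (a * b)) := by
    field_simp; ring
  nlinarith [mul_pos ha hb, mul_pos (sub_pos.2 hab) (sub_pos.2 hb2)]

theorem RootedSubtree.entry_resolvent (T : RootedSubtree S root p d C D q Q) (hq : 2 ≤ q)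
    (hqQ : q ≤ Q) {B : L2 V →L[ℂ] L2 V} (hB : IsLoopedAdjacency B (nbr root p C D) (loops S))
    {b a l : ℝ} (hb : 0 < b) (ha : 0 < a) (hb1 : (q - 1) * b ^ 2 < 1) (ha1 : (Q - 1) * a ^ 2 < 1)
    (hla : l = 1 / a + (Q - 1) * a) (hlb : l = 1 / b + (q - 1) * b + (Q - q) * a + 1)
    (hu : IsUnit ((l : ℂ) • (1 : L2 V →L[ℂ] L2 V) - B)) :
    entry (ResR B l) root root = (((1 / b - b)⁻¹ : ℝ) : ℂ) := by
  have hq' : (2 : ℝ) ≤ q := by exact_mod_cast hq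
  have hs := T.summable_treeFn_sq hqQ (by omega) hb ha hb1 ha1
  have hc : 1 / b - b ≠ 0 := by
    have : 1 / b - b = (1 - b ^ 2) / b := by field_simp
    rw [this]
    exact (div_pos (by nlinarith [sq_nonneg b]) hb).ne'
  have hf : ((l : ℂ) • (1 : L2 V →L[ℂ] L2 V) - B) (L2.ofReal _ hs) =
      ((1 / b - b : ℝ) : ℂ) • delta root := by
    ext x
    have e1 : (((l : ℂ) • (1 : L2 V →L[ℂ] L2 V) - B) (L2.ofReal _ hs) : ∀ _ : V, ℂ) x =
        (l : ℂ) * L2.ofReal _ hs x - B (L2.ofReal _ hs) x := rfl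
    have e2 : ((((1 / b - b : ℝ) : ℂ) • delta root : L2 V) : ∀ _ : V, ℂ) x =
        ((1 / b - b : ℝ) : ℂ) * delta root x := rfl
    rw [e1, e2, T.apply_treeFn hB hb ha, L2.ofReal_apply, delta_apply]
    unfold eigenFactor loops
    by_cases hx : x = root
    · subst hx
      rw [if_pos rfl, if_pos rfl, if_pos T.root_mem, T.treeFn_root, hlb, mul_one]
      push_cast
      ring
    · rw [if_neg hx, if_neg hx, mul_zero, ← Complex.ofReal_mul, ← Complex.ofReal_sub,
        ← sub_mul, Complex.ofReal_eq_zero]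
      refine mul_eq_zero_of_left ?_ _
      split_ifs
      · rw [hlb]; ring
      · rw [hla]; ring
  have h1 : ResR B l (((l : ℂ) • (1 : L2 V →L[ℂ] L2 V) - B) (L2.ofReal _ hs)) =
      L2.ofReal _ hs := DFunLike.congr_fun (Ring.inverse_mul_cancel _ hu) _
  rw [hf, map_smul] at h1
  have h2 : ((1 / b - b : ℝ) : ℂ) * entry (ResR B l) root root = 1 := by
    have := congrFun (congrArg (fun g : L2 V => (g : ∀ _ : V, ℂ)) h1) root
    simp only [L2.ofReal_apply, T.treeFn_root, Complex.ofReal_one] at this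
    exact this
  rw [Complex.ofReal_inv]
  exact eq_inv_of_mul_eq_one_right h2

theorem isUnit_smul_one_sub {B : L2 V →L[ℂ] L2 V} {l : ℝ} (h : ‖B‖ < l) :
    IsUnit ((l : ℂ) • (1 : L2 V →L[ℂ] L2 V) - B) := by
  have hl : ‖B‖ < ‖(l : ℂ)‖ := by
    rwa [Complex.norm_real, Real.norm_of_nonneg ((norm_nonneg B).trans h.le)]
  have : (l : ℂ) ∈ resolventSet ℂ B := by
    cases subsingleton_or_nontrivial (L2 V →L[ℂ] L2 V)
    · exact isUnit_of_subsingleton _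
    · exact spectrum.mem_resolventSet_of_norm_lt hl
  rwa [spectrum.mem_resolventSet_iff, Algebra.algebraMap_eq_smul_one] at this

end Norm

/-- **Theorem 6.6.** For `2 < q ≤ Q ≤ Q(q)`, with `S` a subtree of constant internal
degree `q` rooted at `0 ∈ S`, `A_{𝔾^{Q,q}} = A + P_{ℓ²(S)}` and `λ* = ‖A_{𝔾^{Q,q}}‖ >
2√(Q−1)`: for every `λ > λ*` the operator `I_{ℓ²(S)} − S(λ)` is invertible (witnessed by
its corner inverse `M`) and `R_{A_{𝔾^{Q,q}}}(λ) = R_A(λ)(I + P_{ℓ²(S)}(I − S(λ))⁻¹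
P_{ℓ²(S)} R_A(λ))`; moreover `A_{𝔾^{Q,q}}` is transient, with
`lim_{λ ↓ λ*} ⟨R(λ)δ_0, δ_0⟩ = (1 − a(λ*)√(q−1))²√(q−1)/(a(λ*)(q−2)) < ∞`. -/
theorem resolvent_and_transience_GQq (q Q : ℕ) (hq : 2 < q) (hQq : q ≤ Q)
    (hQb : Q ≤ Qbound q)
    {V : Type} (G : SimpleGraph V) (hG : IsCayleyTree G Q)
    (A : L2 V →L[ℂ] L2 V) (hA : IsAdjacencyOp G A) (hsa : IsSelfAdjoint A)
    (P : Set V → (L2 V →L[ℂ] L2 V)) (hP : IsProjFamily P)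
    (S : Set V) (hS : IsRegularSubtree G S q)
    (root : V) (hroot : root ∈ S)
    (lamstar : ℝ) (hnorm : lamstar = ‖A + P S‖)
    (hl : 2 * Real.sqrt ((Q : ℝ) - 1) < lamstar) :
    (∀ l : ℝ, lamstar < l →
      ∃ M : L2 V →L[ℂ] L2 V, IsCornerInverse (P S) M (ResR A l) ∧
        ResR (A + P S) l =
          ResR A l ∘L ((1 : L2 V →L[ℂ] L2 V) + M ∘L ResR A l))
    ∧ Tendsto (fun l : ℝ => entry (ResR (A + P S) l) root root)
        (𝓝[>] lamstar)
        (𝓝 ((((1 - aF Q lamstar * Real.sqrt ((q : ℝ) - 1)) ^ 2 *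
            Real.sqrt ((q : ℝ) - 1) / (aF Q lamstar * ((q : ℝ) - 2)) : ℝ)) : ℂ)) := by
  obtain ⟨p, d, C, D, T, hadj⟩ := exists_rootedSubtree hG (by omega) hS hroot
  have hA' : IsLoopedAdjacency A (nbr root p C D) 0 :=
    hA.isLoopedAdjacency fun x y => (hadj x y).trans (mem_nbr x y).symm
  have hB : IsLoopedAdjacency (A + P S) (nbr root p C D) (loops S) := hA'.add_proj hP S
  have hAnorm := T.adjacency_norm_le (by omega) hA'
  have hPP : P S * P S = P S := by
    ext f x
    change (P S (P S f) : ∀ _ : V, ℂ) x = P S f x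
    rw [hP, hP]
    split_ifs <;> rfl
  have hunit : ∀ l, lamstar < l → IsUnit ((l : ℂ) • (1 : L2 V →L[ℂ] L2 V) - (A + P S)) :=
    fun l h => isUnit_smul_one_sub (hnorm ▸ h)
  refine ⟨fun l h => exists_cornerInverse A (P S) hPP l
    (isUnit_smul_one_sub (hAnorm.trans_lt (hl.trans h))) (hunit l h), ?_⟩
  have hq' : (2 : ℝ) < q := by exact_mod_cast hq
  have hQ' : (q : ℝ) ≤ Q := by exact_mod_cast hQq
  obtain ⟨ha, hla, ha1⟩ := aF_spec (show 1 < Q by omega) hl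
  have hz : lamstar - 1 - (Q - q) * aF Q lamstar = 2 * √((q : ℝ) - 1) := by
    have h1 := T.two_sqrt_le hq.le hQq hB ha ha1 (hnorm ▸ hla)
    have h2 := T.le_two_sqrt hq.le hQq hB ha ha1 (hnorm ▸ hla)
    linarith
  have hrr : √((q : ℝ) - 1) ^ 2 = q - 1 := Real.sq_sqrt (by linarith)
  have hr : 0 < √((q : ℝ) - 1) := Real.sqrt_pos.2 (by linarith)
  have hlim : ContinuousAt (fun l : ℝ => ((((1 / aF q (l - 1 - (Q - q) * aF Q l) -
      aF q (l - 1 - (Q - q) * aF Q l))⁻¹ : ℝ)) : ℂ)) lamstar := by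
    have c1 : ContinuousAt (fun l : ℝ => l - 1 - (Q - q) * aF Q l) lamstar :=
      (continuousAt_id.sub continuousAt_const).sub
        (continuousAt_const.mul (continuousAt_aF Q (by
          have := Real.sqrt_nonneg ((Q : ℝ) - 1)
          linarith)))
    have c2 : ContinuousAt (fun l : ℝ => aF q (l - 1 - (Q - q) * aF Q l)) lamstar :=
      ContinuousAt.comp (f := fun l : ℝ => l - 1 - (Q - q) * aF Q l)
        (continuousAt_aF q (by rw [hz]; positivity)) c1
    refine Complex.continuous_ofReal.continuousAt.comp (((continuousAt_const.div c2 ?_).sub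
      c2).inv₀ ?_)
    · rw [hz, aF_two_sqrt (by omega)]
      positivity
    · simp only [Pi.sub_apply, Pi.div_apply]
      rw [hz, aF_two_sqrt (by omega), one_div_one_div, sub_ne_zero]
      intro h
      rw [eq_div_iff hr.ne', ← sq, hrr] at h
      linarith
  have hval : (1 / aF q (lamstar - 1 - (Q - q) * aF Q lamstar) -
      aF q (lamstar - 1 - (Q - q) * aF Q lamstar))⁻¹ =
      (1 - aF Q lamstar * √((q : ℝ) - 1)) ^ 2 * √((q : ℝ) - 1) /
        (aF Q lamstar * ((q : ℝ) - 2)) := by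
    rw [hz, aF_two_sqrt (by omega), one_div_one_div]
    have h1 : (1 - aF Q lamstar * √((q : ℝ) - 1)) ^ 2 = aF Q lamstar := by
      have h2 : 1 / aF Q lamstar - 1 + (q - 1) * aF Q lamstar = 2 * √((q : ℝ) - 1) := by linarith
      field_simp at h2
      rw [sub_sq, mul_pow, hrr]
      linarith
    have h3 : √((q : ℝ) - 1) - 1 / √((q : ℝ) - 1) = (q - 2) / √((q : ℝ) - 1) := by
      rw [eq_div_iff hr.ne', sub_mul, ← sq, hrr, one_div_mul_cancel hr.ne']
      ring
    rw [h1, h3, inv_div, mul_div_mul_left _ _ ha.ne']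
  have hlim := hlim.tendsto
  rw [hval] at hlim
  refine (hlim.mono_left nhdsWithin_le_nhds).congr' ?_
  filter_upwards [self_mem_nhdsWithin] with l hll
  have hll : lamstar < l := hll
  obtain ⟨ha', hla', ha1'⟩ := aF_spec (show 1 < Q by omega) (hl.trans hll)
  have hmono := aF_lt_aF (show 1 < Q by omega) hl hll
  have hz' : 2 * √((q : ℝ) - 1) < l - 1 - (Q - q) * aF Q l := by
    rw [← hz]
    nlinarith
  obtain ⟨hb, hlb, hb1⟩ := aF_spec (show 1 < q by omega) hz'
  exact (T.entry_resolvent hq.le hQq hB hb ha' hb1 ha1' hla' (by linarith) (hunit l hll)).symm
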